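/- arXiv:1407.8460 — 3 statements merged into one kernel-verified Lean document; each statement's English description precedes it below -/
import Mathlib

section
/- Let d ≥ 2, L_0 ≥ 1, n ≥ 0, and let γ be a *-connected path in ℤ^d. If x ∈ 𝓛_n = L_n ℤ^d is such that the range {γ} intersects both S(x, L_n − 1) and S(x, 2L_n), then there exists a proper embedding 𝒯 ∈ Λ_{n,x} such that {γ} ∩ S(𝒯(m), L_0 − 1) ≠ ∅ for every leaf m ∈ T_{(n)}. -/
/-- The ℓ∞-norm on `ℤ^d`. -/
def linf {d : ℕ} (x : Fin d → ℤ) : ℤ := ((Finset.univ.sup fun i => (x i).natAbs : ℕ) : ℤ)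

/-- The ℓ∞-sphere `S(x,R)` in `ℤ^d`. -/
def sphereZ {d : ℕ} (x : Fin d → ℤ) (R : ℤ) : Set (Fin d → ℤ) := {y | linf (y - x) = R}

/-- The lattice `L ℤ^d`. -/
def lattice (d : ℕ) (L : ℤ) : Set (Fin d → ℤ) := {x | ∀ i, L ∣ x i}

/-- The scales `L_j = L_0 · 6^j`. -/
def Ln (L0 : ℤ) (j : ℕ) : ℤ := L0 * 6 ^ j

/-- Vertices of the dyadic tree `T_n`: sequences over `{1,2}` (here `Bool`)
of length at most `n`; the length is the depth of the vertex. -/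
def TreeVert (n : ℕ) := {l : List Bool // l.length ≤ n}

/-- `𝒯` is a proper embedding of `T_n` into `ℤ^d` with root at `x`:
(1) the root is mapped to `x`; (2) a vertex at depth `k` is mapped into `𝓛_{n-k}`;
(3) for a vertex `m` at depth `k < n`, its first child (append `false`) is at
ℓ∞-distance `L_{n-k}` from `m` and its second child (append `true`) is at
ℓ∞-distance `2 L_{n-k}` from `m`. -/
def ProperEmbedding (d n : ℕ) (L0 : ℤ) (x : Fin d → ℤ)
    (T : TreeVert n → (Fin d → ℤ)) : Prop :=
  T ⟨[], by simp⟩ = x ∧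
  (∀ (l : List Bool) (h : l.length ≤ n),
    T ⟨l, h⟩ ∈ lattice d (Ln L0 (n - l.length))) ∧
  (∀ (l : List Bool) (h : l.length < n),
    linf (T ⟨l ++ [false], by simpa using h⟩ - T ⟨l, h.le⟩) = Ln L0 (n - l.length) ∧
    linf (T ⟨l ++ [true], by simpa using h⟩ - T ⟨l, h.le⟩) = 2 * Ln L0 (n - l.length))

/-- `Λ_{n,x}`, the set of proper embeddings of `T_n` with root at `x`. -/
def Lambda (d n : ℕ) (L0 : ℤ) (x : Fin d → ℤ) : Set (TreeVert n → (Fin d → ℤ)) :=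
  {T | ProperEmbedding d n L0 x T}

/-- `γ : {0,…,l} → ℤ^d` is a `*`-connected path. -/
def StarPath {d : ℕ} (γ : ℕ → Fin d → ℤ) (l : ℕ) : Prop :=
  ∀ i, 1 ≤ i → i ≤ l → linf (γ i - γ (i - 1)) = 1

/-- The range `{γ}` of the path `γ : {0,…,l} → ℤ^d`. -/
def pathRange {d : ℕ} (γ : ℕ → Fin d → ℤ) (l : ℕ) : Set (Fin d → ℤ) :=
  γ '' {i | i ≤ l}

theorem linf_nonneg {d : ℕ} (x : Fin d → ℤ) : 0 ≤ linf x := Int.natCast_nonneg _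

theorem linf_le_iff {d : ℕ} {x : Fin d → ℤ} {R : ℤ} (hR : 0 ≤ R) :
    linf x ≤ R ↔ ∀ i, |x i| ≤ R := by
  lift R to ℕ using hR
  simp only [linf, Nat.cast_le, Finset.sup_le_iff, Finset.mem_univ, forall_true_left]
  refine forall_congr' fun i => ?_
  rw [Int.abs_eq_natAbs, Nat.cast_le]

theorem abs_apply_le_linf {d : ℕ} (x : Fin d → ℤ) (i : Fin d) : |x i| ≤ linf x :=
  (linf_le_iff (linf_nonneg x)).1 le_rfl i

theorem exists_abs_apply_eq_linf {d : ℕ} {x : Fin d → ℤ} (hx : 0 < linf x) :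
    ∃ i, |x i| = linf x := by
  by_contra! h
  have : linf x ≤ linf x - 1 :=
    (linf_le_iff (by omega)).2 fun i => by
      have := lt_of_le_of_ne (abs_apply_le_linf x i) (h i)
      omega
  omega

theorem linf_sub_comm {d : ℕ} (x y : Fin d → ℤ) : linf (x - y) = linf (y - x) := by
  refine le_antisymm ((linf_le_iff (linf_nonneg _)).2 fun i => ?_)
    ((linf_le_iff (linf_nonneg _)).2 fun i => ?_)
  · rw [Pi.sub_apply, abs_sub_comm]
    exact abs_apply_le_linf (y - x) i
  · rw [Pi.sub_apply, abs_sub_comm]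
    exact abs_apply_le_linf (x - y) i

theorem linf_sub_le {d : ℕ} (x y z : Fin d → ℤ) :
    linf (x - z) ≤ linf (x - y) + linf (y - z) := by
  refine (linf_le_iff (add_nonneg (linf_nonneg _) (linf_nonneg _))).2 fun i => ?_
  have h₁ := abs_apply_le_linf (x - y) i
  have h₂ := abs_apply_le_linf (y - z) i
  have h₃ := abs_sub_le (x i) (y i) (z i)
  simp only [Pi.sub_apply] at *
  omega

/-- Discrete intermediate value theorem for increasing crossings. -/
theorem exists_eq_of_step_le_one {f : ℕ → ℤ} {a b : ℕ} (hab : a ≤ b) {c : ℤ}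
    (hf : ∀ i, a ≤ i → i < b → f (i + 1) ≤ f i + 1) (ha : f a ≤ c) (hb : c ≤ f b) :
    ∃ i, a ≤ i ∧ i ≤ b ∧ f i = c := by
  induction b, hab using Nat.le_induction with
  | base => exact ⟨a, le_rfl, le_rfl, le_antisymm ha hb⟩
  | succ b hab ih =>
    by_cases h : c ≤ f b
    · obtain ⟨i, hi, hib, hc⟩ := ih (fun i h₁ h₂ => hf i h₁ (by omega)) h
      exact ⟨i, hi, by omega, hc⟩
    · have := hf b hab (by omega)
      exact ⟨b + 1, by omega, le_rfl, by omega⟩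

/-- A `*`-connected path meets every sphere lying between two of its points. -/
theorem StarPath.inter_sphereZ_nonempty {d : ℕ} {γ : ℕ → Fin d → ℤ} {l : ℕ}
    (hγ : StarPath γ l) {y p q : Fin d → ℤ} (hp : p ∈ pathRange γ l) (hq : q ∈ pathRange γ l)
    {R : ℤ} (hpR : linf (p - y) ≤ R) (hRq : R ≤ linf (q - y)) :
    (pathRange γ l ∩ sphereZ y R).Nonempty := by
  obtain ⟨a, ha, rfl⟩ := hp
  obtain ⟨b, hb, rfl⟩ := hq
  simp only [Set.mem_ofPred_eq] at ha hb
  have key : ∀ i, i < l → linf (γ (i + 1) - γ i) = 1 := fun i hi => by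
    simpa using hγ (i + 1) (by omega) (by omega)
  rcases le_total a b with hab | hab
  · obtain ⟨i, -, hi, hc⟩ := exists_eq_of_step_le_one (f := fun i => linf (γ i - y)) hab
      (fun i _ hi => by
        have h₁ := key i (by omega)
        have h₂ := linf_sub_le (γ (i + 1)) (γ i) y
        omega) hpR hRq
    exact ⟨γ i, ⟨i, hi.trans hb, rfl⟩, hc⟩
  · obtain ⟨i, -, hi, hc⟩ := exists_eq_of_step_le_one (f := fun i => -linf (γ i - y)) (c := -R) hab
      (fun i _ hi => by
        have h₁ := key i (by omega)
        have h₂ := linf_sub_le (γ i) (γ (i + 1)) y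
        rw [linf_sub_comm] at h₁
        omega) (neg_le_neg hRq) (neg_le_neg hpR)
    exact ⟨γ i, ⟨i, hi.trans ha, rfl⟩, neg_injective hc⟩

/-- A point of `S(x, kL)`, with `x ∈ L ℤ^d`, can be rounded to a point of `L ℤ^d`
on the same sphere. -/
theorem exists_mem_lattice_linf_sub_le {d : ℕ} {L k : ℤ} (hL : 0 < L) (hk : 0 < k)
    {x z : Fin d → ℤ} (hx : x ∈ lattice d L) (hz : linf (z - x) = k * L) :
    ∃ y ∈ lattice d L, linf (y - x) = k * L ∧ linf (z - y) ≤ L - 1 := by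
  have hkL : 0 < k * L := mul_pos hk hL
  have hr₀ : ∀ i, 0 ≤ (z i - x i) % L := fun i => Int.emod_nonneg _ hL.ne'
  have hr₁ : ∀ i, (z i - x i) % L < L := fun i => Int.emod_lt_of_pos _ hL
  have hdiv : ∀ i, L * ((z i - x i) / L) + (z i - x i) % L = z i - x i :=
    fun i => Int.mul_ediv_add_emod _ _
  refine ⟨fun i => x i + L * ((z i - x i) / L),
    fun i => dvd_add (hx i) (dvd_mul_right _ _), le_antisymm ?_ ?_, ?_⟩
  · refine (linf_le_iff hkL.le).2 fun i => ?_
    have hi := abs_apply_le_linf (z - x) i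
    rw [hz, Pi.sub_apply, abs_le] at hi
    have h₁ : -k ≤ (z i - x i) / L := by
      rw [Int.le_ediv_iff_mul_le hL]
      linarith
    rw [Pi.sub_apply, add_sub_cancel_left, abs_le]
    constructor
    · nlinarith
    · linarith [hr₀ i, hdiv i]
  · obtain ⟨i, hi⟩ := exists_abs_apply_eq_linf (x := z - x) (by omega)
    rw [hz, Pi.sub_apply] at hi
    refine le_trans (le_of_eq ?_) (abs_apply_le_linf _ i)
    have hdvd : L ∣ z i - x i := (dvd_abs _ _).1 (hi ▸ dvd_mul_left L k)
    rw [Pi.sub_apply, add_sub_cancel_left, Int.mul_ediv_cancel' hdvd, hi]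
  · refine (linf_le_iff (by omega)).2 fun i => ?_
    have h₀ := hr₀ i
    have h₁ := hr₁ i
    have h₂ := hdiv i
    rw [Pi.sub_apply, abs_le]
    constructor <;> linarith [Int.add_one_le_iff.2 h₁]

theorem Ln_pos {L0 : ℤ} (hL0 : 1 ≤ L0) (n : ℕ) : 0 < Ln L0 n :=
  mul_pos (by omega) (by positivity)

theorem Ln_succ (L0 : ℤ) (n : ℕ) : Ln L0 (n + 1) = 6 * Ln L0 n := by
  unfold Ln
  ring

/-- Crossing the annulus around `x` at scale `n + 1` forces crossings, at scale `n`, around some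
point of `S(x, L_{n+1})` and some point of `S(x, 2 L_{n+1})`. -/
theorem StarPath.exists_crossing {d : ℕ} {γ : ℕ → Fin d → ℤ} {l : ℕ} (hγ : StarPath γ l)
    {L : ℤ} (hL : 0 < L) {x : Fin d → ℤ} (hx : x ∈ lattice d L)
    (h₁ : (pathRange γ l ∩ sphereZ x (6 * L - 1)).Nonempty)
    (h₂ : (pathRange γ l ∩ sphereZ x (2 * (6 * L))).Nonempty) (b : Bool) :
    ∃ y ∈ lattice d L, linf (y - x) = (if b then 2 else 1) * (6 * L) ∧
      (pathRange γ l ∩ sphereZ y (L - 1)).Nonempty ∧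
      (pathRange γ l ∩ sphereZ y (2 * L)).Nonempty := by
  obtain ⟨p, hp, hpx⟩ := h₁
  obtain ⟨q, hq, hqx⟩ := h₂
  simp only [sphereZ, Set.mem_ofPred_eq] at hpx hqx
  suffices ∃ y ∈ lattice d L, linf (y - x) = (if b then 2 else 1) * (6 * L) ∧
      ∃ z ∈ pathRange γ l, ∃ w ∈ pathRange γ l, linf (z - y) ≤ L - 1 ∧ 2 * L ≤ linf (w - y) by
    obtain ⟨y, hy, hyx, z, hz, w, hw, hzy, hwy⟩ := this
    exact ⟨y, hy, hyx, hγ.inter_sphereZ_nonempty hz hw hzy (by omega),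
      hγ.inter_sphereZ_nonempty hz hw (by omega) hwy⟩
  cases b with
  | false =>
    obtain ⟨z, hz, hzx⟩ := hγ.inter_sphereZ_nonempty (y := x) (R := 6 * L) hp hq
      (by omega) (by omega)
    obtain ⟨y, hy, hyx, hzy⟩ := exists_mem_lattice_linf_sub_le hL (by norm_num) hx hzx
    have := linf_sub_le q y x
    exact ⟨y, hy, by simpa using hyx, z, hz, q, hq, hzy, by omega⟩
  | true =>
    obtain ⟨y, hy, hyx, hzy⟩ := exists_mem_lattice_linf_sub_le (k := 12) hL (by norm_num) hx
      (z := q) (by omega)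
    have := linf_sub_le y p x
    rw [linf_sub_comm y p] at this
    exact ⟨y, hy, by simp only [if_true]; omega, q, hq, p, hp, hzy, by omega⟩

/-- The proper embedding, as a function on all finite sequences. -/
theorem StarPath.exists_embedding {d : ℕ} {L0 : ℤ} (hL0 : 1 ≤ L0)
    {γ : ℕ → Fin d → ℤ} {l : ℕ} (hγ : StarPath γ l) (n : ℕ)
    (x : Fin d → ℤ) (hx : x ∈ lattice d (Ln L0 n))
    (h₁ : (pathRange γ l ∩ sphereZ x (Ln L0 n - 1)).Nonempty)
    (h₂ : (pathRange γ l ∩ sphereZ x (2 * Ln L0 n)).Nonempty) :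
    ∃ f : List Bool → Fin d → ℤ, f [] = x ∧
      (∀ m, m.length ≤ n → f m ∈ lattice d (Ln L0 (n - m.length))) ∧
      (∀ m, m.length < n → ∀ b : Bool,
        linf (f (m ++ [b]) - f m) = (if b then 2 else 1) * Ln L0 (n - m.length)) ∧
      ∀ m, m.length = n → (pathRange γ l ∩ sphereZ (f m) (L0 - 1)).Nonempty := by
  induction n generalizing x with
  | zero =>
    refine ⟨fun _ => x, rfl, fun m _ => by simpa using hx, fun m hm => by omega, fun m _ => ?_⟩
    simpa [Ln] using h₁
  | succ n ih =>
    have hx' : x ∈ lattice d (Ln L0 n) := fun i =>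
      (Dvd.intro_left 6 (Ln_succ L0 n).symm).trans (hx i)
    rw [Ln_succ] at h₁ h₂
    choose y hy hyx hy₁ hy₂ using hγ.exists_crossing (Ln_pos hL0 n) hx' h₁ h₂
    choose g hg hlat hdist hleaf using fun b => ih (y b) (hy b) (hy₁ b) (hy₂ b)
    refine ⟨fun | [] => x | b :: m => g b m, rfl, ?_, ?_, ?_⟩
    · rintro (_ | ⟨b, m⟩) hm
      · exact hx
      · simpa using hlat b m (by simpa using hm)
    · rintro (_ | ⟨b, m⟩) hm c
      · simpa [hg, Ln_succ] using hyx c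
      · simpa using hdist b m (by simpa using hm) c
    · rintro (_ | ⟨b, m⟩) hm
      · simp at hm
      · exact hleaf b m (by simpa using hm)

/-- if a `*`-connected path `γ` in `ℤ^d`, `d ≥ 2`, meets both
`S(x, L_n - 1)` and `S(x, 2 L_n)` for some `x ∈ 𝓛_n`, then there is a proper
embedding `𝒯 ∈ Λ_{n,x}` such that `{γ}` meets `S(𝒯(m), L_0 - 1)` for every
leaf `m ∈ T_{(n)}`. -/
theorem path_crossing_gives_proper_embedding (d : ℕ) (hd : 2 ≤ d)
    (L0 : ℤ) (hL0 : 1 ≤ L0) (n : ℕ)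
    (γ : ℕ → Fin d → ℤ) (l : ℕ) (hγ : StarPath γ l)
    (x : Fin d → ℤ) (hx : x ∈ lattice d (Ln L0 n))
    (h1 : (pathRange γ l ∩ sphereZ x (Ln L0 n - 1)).Nonempty)
    (h2 : (pathRange γ l ∩ sphereZ x (2 * Ln L0 n)).Nonempty) :
    ∃ T ∈ Lambda d n L0 x, ∀ (m : List Bool) (h : m.length = n),
      (pathRange γ l ∩ sphereZ (T ⟨m, h.le⟩) (L0 - 1)).Nonempty := by
  obtain ⟨f, hf, hlat, hdist, hleaf⟩ := hγ.exists_embedding hL0 n x hx h1 h2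
  refine ⟨fun m => f m.1, ⟨hf, hlat, fun m hm => ⟨?_, ?_⟩⟩, hleaf⟩
  · simpa using hdist m hm false
  · simpa using hdist m hm true
end

section
/- For any integers d ≥ 1 and L ≥ 1, the ℓ∞-sphere S(0, 11L + 1) in ℤ^d is contained in the union of the spheres S(z, L − 1) over all z ∈ S(0, 12L) ∩ Lℤ^d. -/
theorem linf_eq_iff {d : ℕ} (hd : 1 ≤ d) (x : Fin d → ℤ) (R : ℤ) :
    linf x = R ↔ (∀ i, |x i| ≤ R) ∧ ∃ i, |x i| = R := by
  have hle : ∀ i, |x i| ≤ linf x := fun i => by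
    rw [Int.abs_eq_natAbs, linf]
    exact_mod_cast Finset.le_sup (f := fun i => (x i).natAbs) (Finset.mem_univ i)
  obtain ⟨j, hj⟩ : ∃ j, |x j| = linf x := by
    obtain ⟨j, -, hj⟩ := Finset.exists_mem_eq_sup Finset.univ
      ⟨(⟨0, hd⟩ : Fin d), Finset.mem_univ _⟩ (fun i => (x i).natAbs)
    exact ⟨j, by rw [Int.abs_eq_natAbs, linf, hj]⟩
  constructor
  · rintro rfl
    exact ⟨hle, j, hj⟩
  · rintro ⟨h, i, hi⟩
    exact le_antisymm (hj ▸ h j) (hi ▸ hle i)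

/-- An integer of absolute value at most `11L + 1` is within `L - 1` of a multiple of `L` of
absolute value at most `12L`; if its absolute value is `11L + 1`, both bounds are attained. -/
theorem exists_dvd_near {L a : ℤ} (hL : 1 ≤ L) (ha : |a| ≤ 11 * L + 1) :
    ∃ b, L ∣ b ∧ |b| ≤ 12 * L ∧ |a - b| ≤ L - 1 ∧
      (|a| = 11 * L + 1 → |b| = 12 * L ∧ |a - b| = L - 1) := by
  by_cases h : |a| = 11 * L + 1
  · rcases abs_choice a with h' | h'
    · exact ⟨12 * L, dvd_mul_left _ _, by grind⟩
    · exact ⟨-(12 * L), (dvd_mul_left _ _).neg_right, by grind⟩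
  · have h₁ := Int.emod_nonneg a (by lia : L ≠ 0)
    have h₂ := Int.emod_lt_of_pos a (by lia : 0 < L)
    have h₃ := Int.mul_ediv_add_emod a L
    obtain ⟨h₄, h₅⟩ := abs_le.mp ha
    have h₆ : -12 ≤ a / L := (Int.le_ediv_iff_mul_le (by lia)).mpr (by lia)
    refine ⟨L * (a / L), dvd_mul_right _ _, ?_, ?_, fun h' => absurd h' h⟩
    · rw [abs_le]
      constructor <;> nlinarith
    · rw [abs_le]
      constructor <;> lia

/-- for `d ≥ 1` and `L ≥ 1`, the ℓ∞-sphere `S(0, 11L + 1)` in `ℤ^d`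
is covered by the spheres `S(z, L - 1)` with `z ∈ S(0, 12L) ∩ L ℤ^d`. -/
theorem sphere_eleven_covered (d : ℕ) (hd : 1 ≤ d) (L : ℤ) (hL : 1 ≤ L) :
    sphereZ (0 : Fin d → ℤ) (11 * L + 1) ⊆
      ⋃ z ∈ sphereZ (0 : Fin d → ℤ) (12 * L) ∩ lattice d L, sphereZ z (L - 1) := by
  intro y hy
  simp only [sphereZ, Set.mem_ofPred_eq, sub_zero, linf_eq_iff hd] at hy
  obtain ⟨hle, j, hj⟩ := hy
  choose z hdvd hz hdist hmax using fun i => exists_dvd_near hL (hle i)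
  simp only [Set.mem_iUnion, exists_prop]
  refine ⟨z, ⟨?_, hdvd⟩, ?_⟩
  · rw [sphereZ, Set.mem_ofPred_eq, sub_zero, linf_eq_iff hd]
    exact ⟨hz, j, (hmax j hj).1⟩
  · rw [sphereZ, Set.mem_ofPred_eq, linf_eq_iff hd]
    exact ⟨hdist, j, (hmax j hj).2⟩
end

section
/- Let d ≥ 3 and L_0 = 1, so L_j = 6^j. For any n ≥ 1, any proper embedding 𝒯 ∈ Λ_{n,0} of the dyadic tree T_n with root at 0 ∈ ℤ^d, and any leaf m ∈ T_{(n)}, one has ∑_{m' ∈ T_{(n)}} (max(|𝒯(m) − 𝒯(m')|, 1))^{2−d} ≤ 5/2, where the sum is over all 2^n leaves and the power is a real power. -/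
theorem linf_zero {d : ℕ} : linf (0 : Fin d → ℤ) = 0 :=
  congrArg Nat.cast (Finset.sup_bot (α := ℕ) (Finset.univ : Finset (Fin d)))

theorem linf_add_le {d : ℕ} (x y : Fin d → ℤ) : linf (x + y) ≤ linf x + linf y := by
  unfold linf
  norm_cast
  refine Finset.sup_le fun i hi => ?_
  have hx := Finset.le_sup (f := fun i => (x i).natAbs) hi
  have hy := Finset.le_sup (f := fun i => (y i).natAbs) hi
  exact (Int.natAbs_add_le _ _).trans (add_le_add hx hy)

/-- The labelling `F` of words moves by `6 ^ (n - k)` or `2 * 6 ^ (n - k)` when the letter `false`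
or `true` is appended to a word of length `k < n`. -/
def HasTreeSteps {d : ℕ} (n : ℕ) (F : List Bool → Fin d → ℤ) : Prop :=
  ∀ (p : List Bool) (b : Bool) (j : ℕ), p.length + (j + 1) = n →
    linf (F (p ++ [b]) - F p) = (if b then 2 else 1) * 6 ^ (j + 1)

/-- A leaf below a vertex of height `j` is at distance at most `2 * (6 + ⋯ + 6 ^ j)` from it. -/
theorem HasTreeSteps.linf_leaf_sub_le {d n : ℕ} {F : List Bool → Fin d → ℤ}
    (hF : HasTreeSteps n F) (u p : List Bool) (h : p.length + u.length = n) :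
    5 * linf (F (p ++ u) - F p) ≤ 2 * (6 ^ (u.length + 1) - 6) := by
  induction u generalizing p with
  | nil => simp [linf_zero]
  | cons b u ih =>
    have hchild := ih (p ++ [b]) (by simp at h ⊢; omega)
    have hstep := hF p b u.length (by simpa using h)
    have htri := linf_sub_le (F (p ++ [b] ++ u)) (F (p ++ [b])) (F p)
    have hpow : (0 : ℤ) < 6 ^ (u.length + 1) := by positivity
    simp only [List.append_assoc, List.singleton_append, List.length_cons] at *
    rw [pow_succ _ (u.length + 1)]
    split_ifs at hstep <;> linarith

/-- Leaves below the two different children of a vertex of height `j` are at distance at least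
`6 ^ j / 5`. -/
theorem HasTreeSteps.pow_le_linf_sub {d n : ℕ} {F : List Bool → Fin d → ℤ}
    (hF : HasTreeSteps n F) (p : List Bool) (b : Bool) (u v : List Bool) (j : ℕ)
    (hu : u.length = j) (hv : v.length = j) (h : p.length + (j + 1) = n) :
    6 ^ (j + 1) ≤ 5 * linf (F (p ++ [b] ++ u) - F (p ++ [!b] ++ v)) := by
  have hleaf₁ := hF.linf_leaf_sub_le u (p ++ [b]) (by simp; omega)
  have hleaf₂ := hF.linf_leaf_sub_le v (p ++ [!b]) (by simp; omega)
  have hstep₁ := hF p b j h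
  have hstep₂ := hF p (!b) j h
  rw [hu] at hleaf₁
  rw [hv] at hleaf₂
  rw [linf_sub_comm] at hleaf₁
  have htri₁ := linf_sub_le (F (p ++ [b])) (F (p ++ [b] ++ u)) (F (p ++ [!b]))
  have htri₂ := linf_sub_le (F (p ++ [b] ++ u)) (F (p ++ [!b] ++ v)) (F (p ++ [!b]))
  have htri₃ := linf_sub_le (F (p ++ [b])) (F (p ++ [!b])) (F p)
  have htri₄ := linf_sub_le (F (p ++ [!b])) (F (p ++ [b])) (F p)
  rw [linf_sub_comm (F (p ++ [!b])) (F (p ++ [b]))] at htri₄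
  cases b <;> simp at * <;> linarith

theorem zpow_two_sub_le_inv {d : ℕ} (hd : 3 ≤ d) {x : ℝ} (hx : 1 ≤ x) :
    x ^ ((2 : ℤ) - d) ≤ x⁻¹ := by
  rw [← zpow_neg_one]
  exact zpow_le_zpow_right₀ hx (by omega)

/-- The sum over the leaves below a vertex of height `j`, seen from one of them. -/
theorem HasTreeSteps.sum_zpow_le {d n : ℕ} (hd : 3 ≤ d) {F : List Bool → Fin d → ℤ}
    (hF : HasTreeSteps n F) (j : ℕ) (p u : List Bool) (hu : u.length = j)
    (h : p.length + j = n) :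
    ∑ s : Fin j → Bool,
        ((max (linf (F (p ++ u) - F (p ++ List.ofFn s))) 1 : ℤ) : ℝ) ^ ((2 : ℤ) - d)
      ≤ 1 + 5 / 4 * (1 - (1 / 3) ^ j) := by
  induction j generalizing p u with
  | zero =>
    rw [List.length_eq_zero_iff] at hu
    simp [hu, linf_zero]
  | succ j ih =>
    obtain ⟨b, u, rfl⟩ := List.exists_cons_of_length_eq_add_one hu
    have hlen : u.length = j := by simpa using hu
    have hsame := ih (p ++ [b]) u hlen (by simp; omega)
    have hother : ∑ s : Fin j → Bool,
        ((max (linf (F (p ++ [b] ++ u) - F (p ++ [!b] ++ List.ofFn s))) 1 : ℤ) : ℝ)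
          ^ ((2 : ℤ) - d) ≤ 5 / 6 * (1 / 3) ^ j := by
      have hterm : ∀ s : Fin j → Bool,
          ((max (linf (F (p ++ [b] ++ u) - F (p ++ [!b] ++ List.ofFn s))) 1 : ℤ) : ℝ)
            ^ ((2 : ℤ) - d) ≤ 5 / 6 ^ (j + 1) := by
        intro s
        have hsep := hF.pow_le_linf_sub p b u (List.ofFn s) j hlen (by simp) h
        generalize linf (F (p ++ [b] ++ u) - F (p ++ [!b] ++ List.ofFn s)) = D at hsep ⊢
        have hone : (1 : ℝ) ≤ ((max D 1 : ℤ) : ℝ) := by exact_mod_cast le_max_right D 1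
        have hfar : (6 : ℝ) ^ (j + 1) ≤ 5 * ((max D 1 : ℤ) : ℝ) := by
          exact_mod_cast hsep.trans (by gcongr; exact le_max_left D 1)
        refine (zpow_two_sub_le_inv hd hone).trans ?_
        rw [inv_eq_one_div, div_le_div_iff₀ (by linarith) (by positivity)]
        linarith
      refine (Finset.sum_le_card_nsmul _ _ _ fun s _ => hterm s).trans_eq ?_
      simp only [Finset.card_univ, Fintype.card_pi, Fintype.card_bool, Finset.prod_const,
        Fintype.card_fin, nsmul_eq_mul, Nat.cast_pow, Nat.cast_ofNat]
      rw [show (6 : ℝ) = 2 * 3 by norm_num, pow_succ, mul_pow, one_div, inv_pow]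
      field_simp
    rw [← (Fin.consEquiv fun _ => Bool).sum_comp, Fintype.sum_prod_type, Fintype.sum_bool]
    have hcons : ∀ (c : Bool) (s : Fin j → Bool),
        List.ofFn ((Fin.consEquiv fun _ => Bool) (c, s)) = c :: List.ofFn s :=
      fun c s => List.ofFn_cons c s
    rw [pow_succ]
    cases b <;>
      simp only [hcons, List.append_assoc, List.singleton_append,
        Bool.not_true, Bool.not_false] at hsame hother ⊢ <;>
      linarith

/-- The extension by zero of a proper embedding to all words has the steps of the tree. -/
theorem hasTreeSteps_of_mem_Lambda {d n : ℕ} {x : Fin d → ℤ} {T : TreeVert n → Fin d → ℤ}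
    (hT : T ∈ Lambda d n 1 x) :
    HasTreeSteps n fun l => if h : l.length ≤ n then T ⟨l, h⟩ else 0 := by
  intro p b j h
  have hp : p.length < n := by omega
  have hj : n - p.length = j + 1 := by omega
  obtain ⟨h₁, h₂⟩ := hT.2.2 p hp
  rw [hj] at h₁ h₂
  have hp' : p.length + 1 ≤ n := hp
  cases b <;> simp_all [Ln, hp.le]

/-- with `L_0 = 1` (so `L_j = 6^j`), for any proper embedding
`𝒯 ∈ Λ_{n,0}` and any leaf `m ∈ T_{(n)}`, the sum over all `2^n` leaves `m'`
(here parametrized by functions `s : Fin n → Bool` via `List.ofFn`) of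
`(|𝒯(m) - 𝒯(m')| ∨ 1)^{2-d}` is at most `5/2`. -/
theorem embedding_green_sum_bound (d : ℕ) (hd : 3 ≤ d) (n : ℕ) (hn : 1 ≤ n)
    (T : TreeVert n → (Fin d → ℤ)) (hT : T ∈ Lambda d n 1 (0 : Fin d → ℤ))
    (m : List Bool) (hm : m.length = n) :
    ∑ s : Fin n → Bool,
        ((max (linf (T ⟨m, hm.le⟩ - T ⟨List.ofFn s, by simp⟩)) 1 : ℤ) : ℝ) ^ ((2 : ℤ) - d)
      ≤ 5 / 2 := by
  have hsum := (hasTreeSteps_of_mem_Lambda hT).sum_zpow_le hd n [] m hm (by simp)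
  have hpow : (0 : ℝ) ≤ (1 / 3) ^ n := by positivity
  simp only [List.nil_append, hm, List.length_ofFn, le_refl, dite_true] at hsum
  linarith
end
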